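/- arXiv:1503.04470 — 2 statements merged into one kernel-verified Lean document; each statement's English description precedes it below -/
import Mathlib

section
/- Let β > 0, c > 0 and x ∈ ℝ³ with x ≠ 0. Then ∫_{|y| ≥ c} |y|^{-2-β} |x−y|^{-2} dy = 2π |x|^{-1-β} ∫_{c/|x|}^{∞} t^{-β-1} ln((1+t)/|1−t|) dt. -/
open MeasureTheory Real

/-- Polar integration of a radial function on the plane. -/
lemma lintegral_radial_plane {G : ℝ → ENNReal} (hG : Measurable G) :
    ∫⁻ p : ℝ × ℝ, G (p.1 ^ 2 + p.2 ^ 2)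
      = ENNReal.ofReal (2 * π) * ∫⁻ s in Set.Ioi (0 : ℝ), ENNReal.ofReal s * G (s ^ 2) := by
  rw [← lintegral_comp_polarCoord_symm, polarCoord_target, Measure.volume_eq_prod,
    ← Measure.prod_restrict]
  have h : ∀ p : ℝ × ℝ, ENNReal.ofReal p.1 •
      (fun q : ℝ × ℝ => G (q.1 ^ 2 + q.2 ^ 2)) (polarCoord.symm p)
      = (ENNReal.ofReal p.1 * G (p.1 ^ 2)) * 1 := by
    intro p
    have : (p.1 * cos p.2) ^ 2 + (p.1 * sin p.2) ^ 2 = p.1 ^ 2 := by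
      linear_combination p.1 ^ 2 * cos_sq_add_sin_sq p.2
    simp [this]
  simp_rw [h]
  rw [lintegral_prod_mul (f := fun s => ENNReal.ofReal s * G (s ^ 2)) (g := fun _ => 1)
    (by fun_prop) (by fun_prop)]
  rw [mul_comm]
  simp only [lintegral_const, one_mul, MeasurableSet.univ, Measure.restrict_apply,
    Set.univ_inter, volume_Ioo]
  congr 2
  ring

/-- The substitution `ρ = √(z² + s²)`, for which `ρ dρ = s ds`. -/
lemma lintegral_mul_comp_sqrt_sq_add_sq (z : ℝ) (H : ℝ → ENNReal) :
    ∫⁻ s in Set.Ioi (0 : ℝ), ENNReal.ofReal s * H (√(z ^ 2 + s ^ 2))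
      = ∫⁻ ρ in Set.Ioi |z|, ENNReal.ofReal ρ * H ρ := by
  have himg : (fun s : ℝ => √(z ^ 2 + s ^ 2)) '' Set.Ioi 0 = Set.Ioi |z| := by
    ext ρ
    simp only [Set.mem_image, Set.mem_Ioi]
    constructor
    · rintro ⟨s, hs, rfl⟩
      rw [← sqrt_sq_eq_abs]
      exact sqrt_lt_sqrt (sq_nonneg z) (by nlinarith)
    · intro h
      have h0 : 0 < ρ := (abs_nonneg z).trans_lt h
      have h1 : z ^ 2 < ρ ^ 2 := sq_lt_sq.2 (by rwa [abs_of_pos h0])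
      refine ⟨√(ρ ^ 2 - z ^ 2), sqrt_pos.2 (by linarith), ?_⟩
      rw [sq_sqrt (by linarith), add_sub_cancel, sqrt_sq h0.le]
  have hderiv : ∀ s ∈ Set.Ioi (0 : ℝ), HasDerivWithinAt (fun s : ℝ => √(z ^ 2 + s ^ 2))
      (s / √(z ^ 2 + s ^ 2)) (Set.Ioi 0) s := by
    intro s hs
    rw [Set.mem_Ioi] at hs
    have := (((hasDerivAt_id s).pow 2).const_add (z ^ 2)).sqrt
      (by simp only [Pi.pow_apply, id]; positivity)
    refine (this.congr_deriv ?_).hasDerivWithinAt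
    simp only [Pi.pow_apply, id]
    field_simp
    norm_num
  have hinj : Set.InjOn (fun s : ℝ => √(z ^ 2 + s ^ 2)) (Set.Ioi 0) := by
    intro s hs t ht hst
    rw [Set.mem_Ioi] at hs ht
    rw [sqrt_inj (by positivity) (by positivity)] at hst
    exact (sq_eq_sq₀ hs.le ht.le).1 (by linarith)
  rw [← himg, lintegral_image_eq_lintegral_abs_deriv_mul measurableSet_Ioi hderiv hinj]
  refine setLIntegral_congr_fun measurableSet_Ioi fun s hs => ?_
  rw [Set.mem_Ioi] at hs
  have hpos : 0 < √(z ^ 2 + s ^ 2) := sqrt_pos.2 (by positivity)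
  rw [← mul_assoc, ← ENNReal.ofReal_mul (abs_nonneg _), abs_of_pos (by positivity),
    div_mul_cancel₀ _ hpos.ne']

/-- Archimedes' formula: integration on `ℝ³` of a function of the norm and one coordinate. -/
lemma lintegral_norm_coord {F : ℝ → ℝ → ENNReal} (hF : Measurable (Function.uncurry F)) :
    ∫⁻ y : EuclideanSpace ℝ (Fin 3), F ‖y‖ (y 0)
      = ENNReal.ofReal (2 * π) * ∫⁻ ρ in Set.Ioi (0 : ℝ),
          ENNReal.ofReal ρ * ∫⁻ z in Set.Ioo (-ρ) ρ, F ρ z := by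
  have hcoord : ∫⁻ y : EuclideanSpace ℝ (Fin 3), F ‖y‖ (y 0)
      = ∫⁻ z : ℝ, ∫⁻ p : ℝ × ℝ, F (√(z ^ 2 + (p.1 ^ 2 + p.2 ^ 2))) z := by
    have e1 := EuclideanSpace.volume_preserving_symm_measurableEquiv_toLp (Fin 3)
    have e2 := volume_preserving_piFinSuccAbove (fun _ : Fin 3 => ℝ) 0
    have e3 := (MeasurePreserving.id (volume : Measure ℝ)).prod (volume_preserving_finTwoArrow ℝ)
    rw [← lintegral_prod (μ := (volume : Measure ℝ)) (ν := (volume : Measure (ℝ × ℝ)))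
      (fun q : ℝ × ℝ × ℝ => F (√(q.1 ^ 2 + (q.2.1 ^ 2 + q.2.2 ^ 2))) q.1)
      (Measurable.aemeasurable (hF.comp (f := fun q : ℝ × ℝ × ℝ =>
        (√(q.1 ^ 2 + (q.2.1 ^ 2 + q.2.2 ^ 2)), q.1)) (by fun_prop)))]
    refine Eq.trans ?_ ((e3.comp (e2.comp e1)).lintegral_comp (hF.comp (f := fun q : ℝ × ℝ × ℝ =>
        (√(q.1 ^ 2 + (q.2.1 ^ 2 + q.2.2 ^ 2)), q.1)) (by fun_prop)))
    refine lintegral_congr fun y => ?_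
    simp [EuclideanSpace.norm_eq, Fin.sum_univ_three, add_assoc, Fin.tail]
  have hinner : ∀ z : ℝ, ∫⁻ p : ℝ × ℝ, F (√(z ^ 2 + (p.1 ^ 2 + p.2 ^ 2))) z
      = ENNReal.ofReal (2 * π) * ∫⁻ ρ in Set.Ioi (0 : ℝ),
        (Set.Ioo (-ρ) ρ).indicator (fun z => ENNReal.ofReal ρ * F ρ z) z := by
    intro z
    rw [lintegral_radial_plane (G := fun w => F (√(z ^ 2 + w)) z)
      (hF.comp (f := fun w => (√(z ^ 2 + w), z)) (by fun_prop)),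
      lintegral_mul_comp_sqrt_sq_add_sq z (fun ρ => F ρ z),
      ← lintegral_indicator measurableSet_Ioi, ← lintegral_indicator measurableSet_Ioi]
    congr 2 with ρ
    by_cases h : |z| < ρ
    · have h0 : 0 < ρ := (abs_nonneg z).trans_lt h
      have h1 : z ∈ Set.Ioo (-ρ) ρ := abs_lt.1 h
      simp [h, h0, h1]
    · have h1 : z ∉ Set.Ioo (-ρ) ρ := fun h' => h (abs_lt.2 h')
      simp only [Set.indicator, Set.mem_Ioi, h, h1, if_false, ite_self]
  have hmeas : Measurable (Function.uncurry fun z ρ : ℝ =>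
      (Set.Ioo (-ρ) ρ).indicator (fun z => ENNReal.ofReal ρ * F ρ z) z) := by
    have hs : MeasurableSet {q : ℝ × ℝ | -q.2 < q.1 ∧ q.1 < q.2} :=
      (measurableSet_lt measurable_snd.neg measurable_fst).inter
        (measurableSet_lt measurable_fst measurable_snd)
    have hm : Measurable fun q : ℝ × ℝ => ENNReal.ofReal q.2 * F q.2 q.1 :=
      (by fun_prop : Measurable fun q : ℝ × ℝ => ENNReal.ofReal q.2).mul
        (hF.comp (f := fun q : ℝ × ℝ => (q.2, q.1)) (by fun_prop))
    exact hm.indicator hs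
  rw [hcoord]
  simp_rw [hinner]
  rw [lintegral_const_mul' _ _ ENNReal.ofReal_ne_top,
    lintegral_lintegral_swap hmeas.aemeasurable]
  congr 1
  refine lintegral_congr fun ρ => ?_
  rw [lintegral_indicator measurableSet_Ioo, lintegral_const_mul' _ _ ENNReal.ofReal_ne_top]

/-- The integral of `|x - y|⁻²` in the height `z` over the sphere `|y| = ρ`, where `|x| = r`. -/
lemma lintegral_inv_sq_sub_mul_add_sq {r ρ : ℝ} (hr : 0 < r) (hρ : 0 < ρ) (hne : ρ ≠ r) :
    ∫⁻ z in Set.Ioo (-ρ) ρ, ENNReal.ofReal ((r ^ 2 - 2 * r * z + ρ ^ 2)⁻¹)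
      = ENNReal.ofReal (r⁻¹ * Real.log ((r + ρ) / |r - ρ|)) := by
  have hsq : 0 < (r - ρ) ^ 2 := by
    have := sub_ne_zero.2 hne.symm
    positivity
  have hpos : ∀ z ∈ Set.Icc (-ρ) ρ, 0 < r ^ 2 - 2 * r * z + ρ ^ 2 := by
    intro z hz
    nlinarith [hz.2, hz.1]
  have hcont : ContinuousOn (fun z : ℝ => (r ^ 2 - 2 * r * z + ρ ^ 2)⁻¹) (Set.Icc (-ρ) ρ) :=
    ContinuousOn.inv₀ (by fun_prop) fun z hz => (hpos z hz).ne'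
  have hle : -ρ ≤ ρ := by linarith
  have hint : IntervalIntegrable (fun z : ℝ => (r ^ 2 - 2 * r * z + ρ ^ 2)⁻¹) volume (-ρ) ρ :=
    ContinuousOn.intervalIntegrable (by rwa [Set.uIcc_of_le hle])
  rw [restrict_Ioo_eq_restrict_Ioc, ← ofReal_integral_eq_lintegral_ofReal
    ((intervalIntegrable_iff_integrableOn_Ioc_of_le hle).1 hint)
    ((ae_restrict_iff' measurableSet_Ioc).2 (Filter.Eventually.of_forall fun z hz =>
      (inv_pos.2 (hpos z ⟨hz.1.le, hz.2⟩)).le)),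
    ← intervalIntegral.integral_of_le hle]
  congr 1
  rw [intervalIntegral.integral_eq_sub_of_hasDerivAt
    (f := fun z => -(2 * r)⁻¹ * Real.log (r ^ 2 - 2 * r * z + ρ ^ 2)) _ hint]
  · have h1 : r ^ 2 - 2 * r * ρ + ρ ^ 2 = |r - ρ| ^ 2 := by rw [sq_abs]; ring
    have h2 : r ^ 2 - 2 * r * -ρ + ρ ^ 2 = (r + ρ) ^ 2 := by ring
    rw [h1, h2, Real.log_pow, Real.log_pow, Real.log_div (by positivity)
      (abs_pos.2 (sub_ne_zero.2 hne.symm)).ne']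
    field_simp
    push_cast
    ring
  · intro z hz
    rw [Set.uIcc_of_le hle] at hz
    have hz' := (hpos z hz).ne'
    have h1 : HasDerivAt (fun z : ℝ => r ^ 2 - 2 * r * z + ρ ^ 2) (-(2 * r)) z := by
      simpa using (((hasDerivAt_id z).const_mul (2 * r)).const_sub (r ^ 2)).add_const (ρ ^ 2)
    refine ((h1.log hz').const_mul (-(2 * r)⁻¹)).congr_deriv ?_
    field_simp

/-- Integration on `ℝ³` of a function of the norm and the inner product with a fixed vector. -/
lemma lintegral_norm_inner {F : ℝ → ℝ → ENNReal} (hF : Measurable (Function.uncurry F))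
    (x : EuclideanSpace ℝ (Fin 3)) :
    ∫⁻ y : EuclideanSpace ℝ (Fin 3), F ‖y‖ (inner ℝ x y)
      = ENNReal.ofReal (2 * π) * ∫⁻ ρ in Set.Ioi (0 : ℝ),
          ENNReal.ofReal ρ * ∫⁻ z in Set.Ioo (-ρ) ρ, F ρ (‖x‖ * z) := by
  obtain ⟨R, hR⟩ : ∃ R : EuclideanSpace ℝ (Fin 3) ≃ₗᵢ[ℝ] EuclideanSpace ℝ (Fin 3),
      R (EuclideanSpace.single 0 ‖x‖) = x :=
    ⟨_, Submodule.reflection_sub (by simp)⟩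
  rw [← lintegral_norm_coord (F := fun ρ z => F ρ (‖x‖ * z))
    (hF.comp (f := fun q : ℝ × ℝ => (q.1, ‖x‖ * q.2)) (by fun_prop)),
    ← R.measurePreserving.lintegral_comp_emb R.toMeasurableEquiv.measurableEmbedding]
  refine lintegral_congr fun y => ?_
  have h : inner ℝ x (R y) = ‖x‖ * y 0 := by
    conv_lhs => rw [← hR]
    rw [R.inner_map_map, EuclideanSpace.inner_single_left]
    simp
  rw [h, R.norm_map]

/-- **Reduction of the far-region integral to a one-dimensional integral.**
For `β > 0`, `c > 0` and `x ∈ ℝ³ \ {0}`,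
`∫_{|y| ≥ c} |y|^{-2-β} |x−y|^{-2} dy = 2π |x|^{-1-β} ∫_{c/|x|}^{∞} t^{-β-1} ln((1+t)/|1−t|) dt`. -/
theorem far_integral_reduction (β c : ℝ) (hβ : 0 < β) (hc : 0 < c)
    (x : EuclideanSpace ℝ (Fin 3)) (hx : x ≠ 0) :
    (∫ y in {y : EuclideanSpace ℝ (Fin 3) | c ≤ ‖y‖}, ‖y‖ ^ (-2 - β) * ‖x - y‖ ^ (-2 : ℝ))
      = 2 * π * ‖x‖ ^ (-1 - β) *
        ∫ t in Set.Ioi (c / ‖x‖), t ^ (-β - 1) * Real.log ((1 + t) / |1 - t|) := by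
  have hr : 0 < ‖x‖ := norm_pos_iff.2 hx
  set r := ‖x‖ with hrdef
  have hlog : ∀ ρ : ℝ, 0 < ρ → 0 ≤ Real.log ((r + ρ) / |r - ρ|) := by
    intro ρ hρ
    rcases eq_or_ne ρ r with rfl | hne
    · simp
    · refine Real.log_nonneg ((one_le_div (abs_pos.2 (sub_ne_zero.2 hne.symm))).2 ?_)
      exact abs_le.2 ⟨by linarith, by linarith⟩
  have hmeasC : MeasurableSet {y : EuclideanSpace ℝ (Fin 3) | c ≤ ‖y‖} :=
    measurableSet_le (by fun_prop) (by fun_prop)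
  have hradial : (∫ y in {y : EuclideanSpace ℝ (Fin 3) | c ≤ ‖y‖},
      ‖y‖ ^ (-2 - β) * ‖x - y‖ ^ (-2 : ℝ))
      = ∫ ρ in Set.Ioi c, 2 * π * (ρ ^ (-1 - β) * (r⁻¹ * Real.log ((r + ρ) / |r - ρ|))) := by
    rw [integral_eq_lintegral_of_nonneg_ae
        (Filter.Eventually.of_forall fun y => by simp only [Pi.zero_apply]; positivity)
        (Measurable.aestronglyMeasurable (by fun_prop)),
      integral_eq_lintegral_of_nonneg_ae
        ((ae_restrict_iff' measurableSet_Ioi).2 (Filter.Eventually.of_forall fun ρ hρ => by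
          have hρ0 : 0 < ρ := hc.trans hρ
          have := hlog ρ hρ0
          simp only [Pi.zero_apply]; positivity))
        (Measurable.aestronglyMeasurable (by fun_prop))]
    congr 1
    let F : ℝ → ℝ → ENNReal := fun ρ w => (Set.Ici c).indicator
      (fun ρ => ENNReal.ofReal (ρ ^ (-2 - β) * (r ^ 2 - 2 * w + ρ ^ 2)⁻¹)) ρ
    have hF : Measurable (Function.uncurry F) :=
      Measurable.indicator (s := {q : ℝ × ℝ | c ≤ q.1})
        (f := fun q : ℝ × ℝ => ENNReal.ofReal (q.1 ^ (-2 - β) * (r ^ 2 - 2 * q.2 + q.1 ^ 2)⁻¹))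
        (by fun_prop) (measurableSet_le (by fun_prop) (by fun_prop))
    calc _ = ∫⁻ y, F ‖y‖ (inner ℝ x y) := by
          rw [← lintegral_indicator hmeasC]
          refine lintegral_congr fun y => ?_
          simp only [F, Set.indicator, Set.mem_ofPred_eq, Set.mem_Ici]
          rw [hrdef, ← norm_sub_sq_real, rpow_neg (norm_nonneg _), rpow_two]
      _ = _ := by
          rw [lintegral_norm_inner hF, ← hrdef, ← lintegral_const_mul' _ _ ENNReal.ofReal_ne_top,
            setLIntegral_congr (Ioi_ae_eq_Ici (a := c)),
            ← lintegral_indicator measurableSet_Ioi, ← lintegral_indicator measurableSet_Ici]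
          refine lintegral_congr_ae ?_
          filter_upwards [compl_mem_ae_iff.2 (measure_singleton (μ := volume) r)] with ρ hne
          by_cases hρ : c ≤ ρ
          · have h0 : 0 < ρ := hc.trans_le hρ
            simp only [Set.indicator, Set.mem_Ioi, Set.mem_Ici, h0, hρ, if_true, F]
            have hpow : 0 ≤ ρ ^ (-2 - β) := by positivity
            simp_rw [ENNReal.ofReal_mul hpow, ← mul_assoc 2 r]
            rw [lintegral_const_mul' _ _ ENNReal.ofReal_ne_top,
              lintegral_inv_sq_sub_mul_add_sq hr h0 hne, ← ENNReal.ofReal_mul hpow,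
              ← ENNReal.ofReal_mul h0.le, ← ENNReal.ofReal_mul (by positivity)]
            congr 1
            rw [show (-1 - β) = (-2 - β) + 1 by ring, rpow_add_one h0.ne']
            ring
          · simp [Set.indicator, hρ, F]
  rw [hradial, ← integral_const_mul]
  have hscale := integral_comp_mul_left_Ioi'
    (fun ρ => 2 * π * (ρ ^ (-1 - β) * (r⁻¹ * Real.log ((r + ρ) / |r - ρ|)))) (c / r) hr
  rw [mul_div_cancel₀ _ hr.ne'] at hscale
  rw [← hscale, smul_eq_mul, ← integral_const_mul]
  refine setIntegral_congr_fun measurableSet_Ioi fun t ht => ?_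
  have ht0 : 0 < t := (div_pos hc hr).trans ht
  have hfrac : (r + r * t) / |r - r * t| = (1 + t) / |1 - t| := by
    rw [show r + r * t = r * (1 + t) by ring, show r - r * t = r * (1 - t) by ring, abs_mul,
      abs_of_pos hr, mul_div_mul_left _ _ hr.ne']
  rw [hfrac, mul_rpow hr.le ht0.le, show -β - 1 = -1 - β by ring]
  field_simp
end

section
/- Let β > 0. There exist constants C₁ ≥ 0 and C₂ ≥ 0 such that for every x ∈ ℝ³ with |x| ≥ 1, taking r = |x|^{1/2}/2, one has ∫_{|y| ≥ r} |y|^{-2-β} |x−y|^{-2} dy ≤ C₁ 2^β |x|^{-1-β/2} + C₂ |x|^{-1-β}. -/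
open MeasureTheory Real

/-- The integral of `‖y‖ ^ (-3 - β)` over the exterior of a ball centred at the origin of `ℝ³`;
the factor `3 * vol (B(0, 1))` is the area of the unit sphere. -/
theorem integrable_integral_norm_rpow_exterior {β r : ℝ} (hβ : 0 < β) (hr : 0 < r) :
    Integrable (fun y : EuclideanSpace ℝ (Fin 3) ↦
        (Set.Ici r).indicator (fun t : ℝ ↦ t ^ (-3 - β)) ‖y‖) ∧
      ∫ y : EuclideanSpace ℝ (Fin 3), (Set.Ici r).indicator (fun t : ℝ ↦ t ^ (-3 - β)) ‖y‖ =
        3 * volume.real (Metric.ball (0 : EuclideanSpace ℝ (Fin 3)) 1) * (r ^ (-β) / β) := by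
  have key : Set.EqOn
      (fun t : ℝ ↦ t ^ (Module.finrank ℝ (EuclideanSpace ℝ (Fin 3)) - 1) •
        (Set.Ici r).indicator (fun t : ℝ ↦ t ^ (-3 - β)) t)
      ((Set.Ici r).indicator fun t : ℝ ↦ t ^ (-1 - β)) (Set.Ioi 0) := by
    intro t ht
    have ht : 0 < t := ht
    by_cases h : t ∈ Set.Ici r
    · simp only [finrank_euclideanSpace, Fintype.card_fin, Set.indicator_of_mem h, smul_eq_mul]
      rw [← rpow_natCast, ← rpow_add ht]
      congr 1
      norm_num
      ring
    · simp [Set.indicator_of_notMem h]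
  have hsub : Set.Ioi 0 ∩ Set.Ici r = Set.Ici r :=
    Set.inter_eq_right.2 fun t ht ↦ hr.trans_le ht
  constructor
  · rw [integrable_fun_norm_addHaar volume, integrableOn_congr_fun key measurableSet_Ioi,
      IntegrableOn, integrable_indicator_iff measurableSet_Ici, IntegrableOn,
      Measure.restrict_restrict measurableSet_Ici, Set.inter_comm, hsub]
    exact (integrableOn_Ici_iff_integrableOn_Ioi).2
      (integrableOn_Ioi_rpow_of_lt (by linarith) hr)
  · rw [integral_fun_norm_addHaar volume, setIntegral_congr_fun measurableSet_Ioi key,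
      setIntegral_indicator measurableSet_Ici, hsub, integral_Ici_eq_integral_Ioi,
      integral_Ioi_rpow_of_lt (by linarith) hr]
    have h : -1 - β + 1 = -β := by ring
    simp only [finrank_euclideanSpace, Fintype.card_fin, h, smul_eq_mul, nsmul_eq_mul,
      neg_div_neg_eq]
    push_cast
    ring

/-- The integral of `‖y‖ ^ (-2)` over a ball centred at the origin of `ℝ³`. -/
theorem integrable_integral_norm_rpow_neg_two_ball {s : ℝ} (hs : 0 ≤ s) :
    Integrable (fun y : EuclideanSpace ℝ (Fin 3) ↦
        (Set.Iio s).indicator (fun t : ℝ ↦ t ^ (-2 : ℝ)) ‖y‖) ∧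
      ∫ y : EuclideanSpace ℝ (Fin 3), (Set.Iio s).indicator (fun t : ℝ ↦ t ^ (-2 : ℝ)) ‖y‖ =
        3 * volume.real (Metric.ball (0 : EuclideanSpace ℝ (Fin 3)) 1) * s := by
  have key : Set.EqOn
      (fun t : ℝ ↦ t ^ (Module.finrank ℝ (EuclideanSpace ℝ (Fin 3)) - 1) •
        (Set.Iio s).indicator (fun t : ℝ ↦ t ^ (-2 : ℝ)) t)
      ((Set.Iio s).indicator fun _ ↦ (1 : ℝ)) (Set.Ioi 0) := by
    intro t ht
    have ht : 0 < t := ht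
    by_cases h : t ∈ Set.Iio s
    · simp only [finrank_euclideanSpace, Fintype.card_fin, Set.indicator_of_mem h, smul_eq_mul]
      rw [← rpow_natCast, ← rpow_add ht]
      norm_num
    · simp [Set.indicator_of_notMem h]
  constructor
  · rw [integrable_fun_norm_addHaar volume, integrableOn_congr_fun key measurableSet_Ioi,
      IntegrableOn, integrable_indicator_iff measurableSet_Iio, IntegrableOn,
      Measure.restrict_restrict measurableSet_Iio, Set.inter_comm, Set.Ioi_inter_Iio]
    exact integrableOn_const (by simp)
  · rw [integral_fun_norm_addHaar volume, setIntegral_congr_fun measurableSet_Ioi key,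
      setIntegral_indicator measurableSet_Iio, Set.Ioi_inter_Iio]
    simp [hs]
    ring

/-- Pointwise domination of the integrand by a piece centred at the origin and a piece centred
at `x`. -/
theorem norm_rpow_mul_norm_sub_rpow_le {E : Type*} [NormedAddCommGroup E] {β r : ℝ} (hβ : 0 < β)
    (hr : 0 < r) {x y : E} (hx : 0 < ‖x‖) (hy : r ≤ ‖y‖) :
    ‖y‖ ^ (-2 - β) * ‖x - y‖ ^ (-2 : ℝ) ≤
      6 * ‖x‖⁻¹ * (Set.Ici r).indicator (fun t : ℝ ↦ t ^ (-3 - β)) ‖y‖ +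
        (‖x‖ / 2) ^ (-2 - β) *
          (Set.Iio (‖x‖ / 2)).indicator (fun t : ℝ ↦ t ^ (-2 : ℝ)) ‖x - y‖ := by
  have hy0 : 0 < ‖y‖ := hr.trans_le hy
  have htri : ‖x‖ ≤ ‖x - y‖ + ‖y‖ := by simpa using norm_add_le (x - y) y
  have htri' : ‖y‖ ≤ ‖x‖ + ‖x - y‖ := by simpa using norm_sub_le x (x - y)
  rw [Set.indicator_of_mem (show ‖y‖ ∈ Set.Ici r from hy)]
  by_cases h : ‖x - y‖ < ‖x‖ / 2
  · rw [Set.indicator_of_mem (show ‖x - y‖ ∈ Set.Iio (‖x‖ / 2) from h)]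
    have h1 : ‖y‖ ^ (-2 - β) ≤ (‖x‖ / 2) ^ (-2 - β) :=
      rpow_le_rpow_of_nonpos (by positivity) (by linarith) (by linarith)
    have h2 : 0 ≤ 6 * ‖x‖⁻¹ * ‖y‖ ^ (-3 - β) := by positivity
    have h3 := mul_le_mul_of_nonneg_right h1 (rpow_nonneg (norm_nonneg (x - y)) (-2))
    linarith
  · rw [Set.indicator_of_notMem (show ‖x - y‖ ∉ Set.Iio (‖x‖ / 2) from h), mul_zero, add_zero]
    have h : ‖x‖ / 2 ≤ ‖x - y‖ := not_lt.1 h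
    have hd : 0 < ‖x - y‖ := by linarith
    have h1 : ‖x - y‖ ^ (-2 : ℝ) ≤ 6 * ‖x‖⁻¹ * ‖y‖⁻¹ := by
      rw [rpow_neg hd.le, rpow_two, mul_assoc, ← mul_inv, ← div_eq_mul_inv,
        le_div_iff₀ (by positivity), inv_mul_le_iff₀ (by positivity)]
      nlinarith [mul_le_mul (show ‖x‖ ≤ 2 * ‖x - y‖ by linarith)
        (show ‖y‖ ≤ 3 * ‖x - y‖ by linarith) hy0.le (by positivity)]
    have h2 : ‖y‖ ^ (-3 - β) = ‖y‖ ^ (-2 - β) * ‖y‖⁻¹ := by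
      rw [← rpow_neg_one, ← rpow_add hy0]
      congr 1
      ring
    calc _ ≤ ‖y‖ ^ (-2 - β) * (6 * ‖x‖⁻¹ * ‖y‖⁻¹) := by gcongr
      _ = _ := by rw [h2]; ring

/-- **Estimate for the far-region integral.**
For `β > 0` there are constants `C₁, C₂ ≥ 0` such that for every `x ∈ ℝ³` with `|x| ≥ 1`,
taking `r = |x|^{1/2}/2`,
`∫_{|y| ≥ r} |y|^{-2-β} |x−y|^{-2} dy ≤ C₁ 2^β |x|^{-1-β/2} + C₂ |x|^{-1-β}`. -/
theorem far_integral_estimate (β : ℝ) (hβ : 0 < β) :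
    ∃ C₁ C₂ : ℝ, 0 ≤ C₁ ∧ 0 ≤ C₂ ∧
      ∀ x : EuclideanSpace ℝ (Fin 3), 1 ≤ ‖x‖ →
        (∫ y in {y : EuclideanSpace ℝ (Fin 3) | ‖x‖ ^ ((1 : ℝ) / 2) / 2 ≤ ‖y‖},
            ‖y‖ ^ (-2 - β) * ‖x - y‖ ^ (-2 : ℝ))
          ≤ C₁ * 2 ^ β * ‖x‖ ^ (-1 - β / 2) + C₂ * ‖x‖ ^ (-1 - β) := by
  set K : ℝ := 3 * volume.real (Metric.ball (0 : EuclideanSpace ℝ (Fin 3)) 1)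
  have hK : 0 ≤ K := by positivity
  refine ⟨6 * K / β, K * 2 ^ (1 + β), by positivity, by positivity, fun x hx ↦ ?_⟩
  have hx0 : 0 < ‖x‖ := by linarith
  set r : ℝ := ‖x‖ ^ ((1 : ℝ) / 2) / 2 with hr_def
  have hr : 0 < r := by positivity
  obtain ⟨hA, hA'⟩ := integrable_integral_norm_rpow_exterior hβ hr
  obtain ⟨hB, hB'⟩ := integrable_integral_norm_rpow_neg_two_ball (half_pos hx0).le
  rw [← integral_sub_left_eq_self _ volume x] at hB'
  have hBx := hB.comp_sub_left x
  have hAc := hA.const_mul (6 * ‖x‖⁻¹)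
  have hBc := hBx.const_mul ((‖x‖ / 2) ^ (-2 - β))
  have hmeas : MeasurableSet {y : EuclideanSpace ℝ (Fin 3) | r ≤ ‖y‖} :=
    measurableSet_le measurable_const measurable_norm
  have hnear : (‖x‖ / 2) ^ (-2 - β) * (K * (‖x‖ / 2)) =
      K * 2 ^ (1 + β) * ‖x‖ ^ (-1 - β) := by
    have h : (‖x‖ / 2) ^ (-2 - β) * (‖x‖ / 2) = (‖x‖ / 2) ^ (-1 - β) := by
      rw [← rpow_add_one (by positivity)]
      congr 1
      ring
    rw [mul_left_comm, h, div_rpow hx0.le zero_le_two, div_eq_mul_inv, ← rpow_neg zero_le_two,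
      show -(-1 - β) = 1 + β by ring]
    ring
  have hfar : 6 * ‖x‖⁻¹ * (K * (r ^ (-β) / β)) =
      6 * K / β * 2 ^ β * ‖x‖ ^ (-1 - β / 2) := by
    have h : r ^ (-β) = ‖x‖ ^ (-(β / 2)) * 2 ^ β := by
      rw [hr_def, div_rpow (by positivity) zero_le_two, ← rpow_mul hx0.le, div_eq_mul_inv,
        ← rpow_neg zero_le_two, neg_neg]
      congr 2
      ring
    rw [h, sub_eq_add_neg, rpow_add hx0, rpow_neg_one]
    ring
  rw [← integral_indicator hmeas, ← hfar, ← hnear, ← hA', ← hB',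
    ← integral_const_mul, ← integral_const_mul, ← integral_add hAc hBc]
  refine integral_mono_of_nonneg (.of_forall fun y ↦ ?_) (hAc.add hBc) (.of_forall fun y ↦ ?_)
  · exact Set.indicator_nonneg (fun y _ ↦ by positivity) y
  · refine Set.indicator_le' (fun y hy ↦ norm_rpow_mul_norm_sub_rpow_le hβ hr hx0 hy)
      (fun y _ ↦ ?_) y
    have h1 : 0 ≤ (Set.Ici r).indicator (fun t : ℝ ↦ t ^ (-3 - β)) ‖y‖ :=
      Set.indicator_apply_nonneg fun _ ↦ by positivity
    have h2 : 0 ≤ (Set.Iio (‖x‖ / 2)).indicator (fun t : ℝ ↦ t ^ (-2 : ℝ)) ‖x - y‖ :=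
      Set.indicator_apply_nonneg fun _ ↦ by positivity
    positivity
end
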